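/- Let (Σ, L, κ) be a state property system satisfying the axiom OrthoCom. Then κ_c restricted to the classical properties is a bijection onto the power set of Ω: it is injective on classical properties, and for every subset A ⊆ Ω there exists a classical property a with κ_c(a) = A. -/

import Mathlib

/-- A state property system `(σ, L, κ)` equipped with an orthocomplementation
satisfying the axiom **OrthoCom**. -/
structure OrthoSPS (σ : Type*) (L : Type*) [CompleteLattice L] where
  /-- the Cartan map -/
  κ : L → Set σ
  κ_bot : κ ⊥ = ∅
  κ_top : κ ⊤ = Set.univ
  κ_sInf : ∀ s : Set L, κ (sInf s) = ⋂ a ∈ s, κ a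
  le_iff : ∀ a b : L, a ≤ b ↔ κ a ⊆ κ b
  /-- the orthocomplementation -/
  perp : L → L
  perp_perp : ∀ a : L, perp (perp a) = a
  perp_anti : ∀ a b : L, a ≤ b → perp b ≤ perp a
  inf_perp : ∀ a : L, a ⊓ perp a = ⊥
  sup_perp : ∀ a : L, a ⊔ perp a = ⊤
  /-- axiom OrthoCom: any state orthogonal to every state in `κ a` lies in `κ (perp a)` -/
  orthoCom : ∀ (a : L) (q : σ),
    (∀ p ∈ κ a, ∃ b : L, q ∈ κ b ∧ p ∈ κ (perp b)) → q ∈ κ (perp a)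

namespace OrthoSPS

variable {σ : Type*} {L : Type*} [CompleteLattice L]

/-- orthogonality of two states: `p ⊥ q` -/
def PerpState (S : OrthoSPS σ L) (p q : σ) : Prop :=
  ∃ a : L, p ∈ S.κ a ∧ q ∈ S.κ (S.perp a)

/-- a property `a` is classical if every state is in `κ a` or in `κ (perp a)` -/
def IsClassical (S : OrthoSPS σ L) (a : L) : Prop :=
  ∀ p : σ, p ∈ S.κ a ∨ p ∈ S.κ (S.perp a)

/-- the classical state `ω p` of a state `p`: the infimum of all classical properties
actual in `p` -/
def classicalState (S : OrthoSPS σ L) (p : σ) : L :=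
  sInf {a : L | S.IsClassical a ∧ p ∈ S.κ a}

/-- `Ω`, the set of all classical states -/
def Omega (S : OrthoSPS σ L) : Set L :=
  Set.range S.classicalState

/-- the classical Cartan map `κ_c` -/
def κc (S : OrthoSPS σ L) (a : L) : Set L :=
  S.classicalState '' S.κ a

end OrthoSPS

namespace OrthoSPS

variable {σ L : Type*} [CompleteLattice L] (S : OrthoSPS σ L)

theorem mem_κ_sInf {s : Set L} {p : σ} : p ∈ S.κ (sInf s) ↔ ∀ a ∈ s, p ∈ S.κ a := by
  simp [S.κ_sInf]

theorem notMem_κ_perp {a : L} {p : σ} (h : p ∈ S.κ a) : p ∉ S.κ (S.perp a) := by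
  intro h'
  have hp : p ∈ S.κ (sInf {a, S.perp a}) := by
    rw [S.mem_κ_sInf]
    rintro b (rfl | rfl) <;> assumption
  rw [sInf_pair, S.inf_perp, S.κ_bot] at hp
  exact hp

variable {S}

theorem IsClassical.mem_κ_perp {a : L} (ha : S.IsClassical a) {p : σ} :
    p ∈ S.κ (S.perp a) ↔ p ∉ S.κ a :=
  ⟨fun h h' => S.notMem_κ_perp h' h, fun h => (ha p).resolve_left h⟩

theorem IsClassical.perp {a : L} (ha : S.IsClassical a) : S.IsClassical (S.perp a) := by
  intro p
  rw [S.perp_perp]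
  exact (ha p).symm

theorem IsClassical.sInf {s : Set L} (hs : ∀ a ∈ s, S.IsClassical a) :
    S.IsClassical (sInf s) := by
  intro p
  by_cases h : ∀ a ∈ s, p ∈ S.κ a
  · exact Or.inl (S.mem_κ_sInf.2 h)
  · push Not at h
    obtain ⟨a, ha, hpa⟩ := h
    exact Or.inr ((S.le_iff _ _).1 (S.perp_anti _ _ (sInf_le ha)) ((hs a ha).mem_κ_perp.2 hpa))

variable (S) in
theorem isClassical_classicalState (p : σ) : S.IsClassical (S.classicalState p) :=
  IsClassical.sInf fun _ h => h.1

variable (S) in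
theorem mem_κ_classicalState (p : σ) : p ∈ S.κ (S.classicalState p) :=
  S.mem_κ_sInf.2 fun _ h => h.2

theorem IsClassical.classicalState_le_iff {a : L} (ha : S.IsClassical a) {p : σ} :
    S.classicalState p ≤ a ↔ p ∈ S.κ a :=
  ⟨fun h => (S.le_iff _ _).1 h (S.mem_κ_classicalState p), fun h => sInf_le ⟨ha, h⟩⟩

theorem mem_κ_classicalState_iff {p q : σ} :
    p ∈ S.κ (S.classicalState q) ↔ S.classicalState p = S.classicalState q := by
  refine ⟨fun h => ?_, fun h => h ▸ S.mem_κ_classicalState p⟩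
  have hp := S.isClassical_classicalState p
  refine le_antisymm ((S.isClassical_classicalState q).classicalState_le_iff.2 h)
    (hp.classicalState_le_iff.2 ?_)
  by_contra hq
  have hle := hp.perp.classicalState_le_iff.2 (hp.mem_κ_perp.2 hq)
  exact S.notMem_κ_perp (S.mem_κ_classicalState p) ((S.le_iff _ _).1 hle h)

theorem IsClassical.classicalState_mem_κc_iff {a : L} (ha : S.IsClassical a) {p : σ} :
    S.classicalState p ∈ S.κc a ↔ p ∈ S.κ a := by
  refine ⟨?_, fun h => ⟨p, h, rfl⟩⟩
  rintro ⟨q, hq, hqp⟩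
  rwa [← ha.classicalState_le_iff, ← hqp, ha.classicalState_le_iff]

theorem IsClassical.le_of_κc_subset {a b : L} (ha : S.IsClassical a) (hb : S.IsClassical b)
    (h : S.κc a ⊆ S.κc b) : a ≤ b :=
  (S.le_iff _ _).2 fun _ hp =>
    hb.classicalState_mem_κc_iff.1 (h (ha.classicalState_mem_κc_iff.2 hp))

/-- Every set of classical properties has a classical upper bound that is actual exactly when
one of its members is. -/
theorem exists_isClassical_κ_eq_iUnion {s : Set L} (hs : ∀ a ∈ s, S.IsClassical a) :
    ∃ a : L, S.IsClassical a ∧ ∀ p, p ∈ S.κ a ↔ ∃ c ∈ s, p ∈ S.κ c := by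
  have hc : S.IsClassical (InfSet.sInf (S.perp '' s)) := by
    refine IsClassical.sInf ?_
    rintro _ ⟨a, ha, rfl⟩
    exact (hs a ha).perp
  refine ⟨S.perp (InfSet.sInf (S.perp '' s)), hc.perp, fun p => ?_⟩
  rw [hc.mem_κ_perp, S.mem_κ_sInf, Set.forall_mem_image]
  push Not
  exact exists_congr fun c => and_congr_right fun hcs => by rw [(hs c hcs).mem_κ_perp, not_not]

end OrthoSPS

/-- `κ_c` restricted to the classical properties is a bijection onto the
power set of `Ω`. -/
theorem κc_bijective_on_classical {σ L : Type*} [CompleteLattice L] (S : OrthoSPS σ L) :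
    (∀ a b : L, S.IsClassical a → S.IsClassical b → S.κc a = S.κc b → a = b) ∧
    (∀ A : Set L, A ⊆ S.Omega → ∃ a : L, S.IsClassical a ∧ S.κc a = A) := by
  refine ⟨fun a b ha hb h => le_antisymm (ha.le_of_κc_subset hb h.subset)
    (hb.le_of_κc_subset ha h.superset), fun A hA => ?_⟩
  have hcl : ∀ c ∈ A, S.IsClassical c := by
    intro c hc
    obtain ⟨q, rfl⟩ := hA hc
    exact S.isClassical_classicalState q
  obtain ⟨a, ha, hκ⟩ := OrthoSPS.exists_isClassical_κ_eq_iUnion hcl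
  refine ⟨a, ha, Set.Subset.antisymm ?_ fun c hc => ?_⟩
  · rintro _ ⟨p, hp, rfl⟩
    obtain ⟨c, hc, hpc⟩ := (hκ p).1 hp
    obtain ⟨q, rfl⟩ := hA hc
    rwa [OrthoSPS.mem_κ_classicalState_iff.1 hpc]
  · obtain ⟨q, rfl⟩ := hA hc
    exact ⟨q, (hκ q).2 ⟨_, hc, S.mem_κ_classicalState q⟩, rfl⟩
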